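/- Let K > 0, R > 1 and s > 0. Then the function x ↦ s^{R+ix} · K^{1−(R+ix)} / ((R+ix)·((R+ix)−1)) is Lebesgue-integrable on ℝ (where u^z := e^{z·log u} for u > 0, z ∈ ℂ), and (1/(2π)) · ∫_ℝ s^{R+ix} · K^{1−(R+ix)} / ((R+ix)·((R+ix)−1)) dx = max(s − K, 0). -/

import Mathlib

open MeasureTheory Complex Real

/-- The Mellin transform of `t ↦ max (1 - t) 0` is `1 / (z * (z + 1))` on `0 < re z`. -/
theorem hasMellin_max_one_sub_zero {z : ℂ} (hz : 0 < z.re) :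
    HasMellin (fun t : ℝ => ((max (1 - t) 0 : ℝ) : ℂ)) z (1 / (z * (z + 1))) := by
  have h₁ := hasMellin_one_Ioc hz
  have h₂ := hasMellin_cpow_Ioc 1 (s := z) (by simp; linarith)
  have h := hasMellin_sub h₁.1 h₂.1
  rw [h₁.2, h₂.2] at h
  have hz₀ : z ≠ 0 := fun h₀ => by simp [h₀] at hz
  have hz₁ : z + 1 ≠ 0 := fun h₀ => by
    have := congrArg re h₀
    simp at this
    linarith
  have hval : 1 / z - 1 / (z + 1) = 1 / (z * (z + 1)) := by
    field_simp
    ring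
  rw [hval] at h
  have hEq : ∀ t ∈ Set.Ioi (0 : ℝ),
      (t : ℂ) ^ (z - 1) • (Set.indicator (Set.Ioc 0 1) (fun _ => 1 : ℝ → ℂ) t -
        Set.indicator (Set.Ioc 0 1) (fun t => ↑t ^ (1 : ℂ) : ℝ → ℂ) t) =
      (t : ℂ) ^ (z - 1) • ((max (1 - t) 0 : ℝ) : ℂ) := by
    intro t ht
    congr 1
    by_cases h1 : t ≤ 1
    · have hmem : t ∈ Set.Ioc (0 : ℝ) 1 := ⟨ht, h1⟩
      simp [hmem, max_eq_left (sub_nonneg.2 h1)]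
    · have hmem : t ∉ Set.Ioc (0 : ℝ) 1 := fun hm => h1 hm.2
      rw [Set.indicator_of_notMem hmem, Set.indicator_of_notMem hmem,
        max_eq_right (by linarith [not_le.1 h1])]
      simp
  exact ⟨h.1.congr_fun hEq measurableSet_Ioi,
    (setIntegral_congr_fun measurableSet_Ioi hEq).symm.trans h.2⟩

theorem integrable_inv_sq_add_sq {a : ℝ} (ha : 0 < a) :
    Integrable (fun y : ℝ => (a ^ 2 + y ^ 2)⁻¹) := by
  refine ((integrable_inv_one_add_sq.comp_div ha.ne').const_mul (a ^ 2)⁻¹).congr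
    (.of_forall fun y => ?_)
  simp only
  rw [← mul_inv]
  field_simp

theorem verticalIntegrable_one_div_mul_add_one {σ : ℝ} (hσ : 0 < σ) :
    VerticalIntegrable (fun z : ℂ => 1 / (z * (z + 1))) σ := by
  refine (integrable_inv_sq_add_sq hσ).mono'
    (Measurable.aestronglyMeasurable (by fun_prop)) (.of_forall fun y => ?_)
  have hle : ‖(σ : ℂ) + y * I‖ ≤ ‖(σ : ℂ) + y * I + 1‖ := by
    rw [← sq_le_sq₀ (norm_nonneg _) (norm_nonneg _), Complex.sq_norm, Complex.sq_norm,
      normSq_apply, normSq_apply]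
    simp
    nlinarith
  have hsq : σ ^ 2 + y ^ 2 = ‖(σ : ℂ) + y * I‖ * ‖(σ : ℂ) + y * I‖ := by
    rw [← sq, Complex.sq_norm, normSq_add_mul_I]
  rw [norm_div, norm_one, norm_mul, one_div]
  refine inv_anti₀ (by positivity) ?_
  rw [hsq]
  gcongr

theorem mellinInv_one_div_mul_add_one {σ x : ℝ} (hσ : 0 < σ) (hx : 0 < x) :
    mellinInv σ (fun z : ℂ => 1 / (z * (z + 1))) x = ((max (1 - x) 0 : ℝ) : ℂ) := by
  have hmellin (y : ℝ) : mellin (fun t : ℝ => ((max (1 - t) 0 : ℝ) : ℂ)) (σ + y * I) =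
      1 / ((σ + y * I) * (σ + y * I + 1)) :=
    (hasMellin_max_one_sub_zero (by simpa using hσ)).2
  rw [← mellinInv_mellin_eq σ (fun t : ℝ => ((max (1 - t) 0 : ℝ) : ℂ)) hx
    (hasMellin_max_one_sub_zero (by simpa using hσ)).1 ?_ (by fun_prop)]
  · simp only [mellinInv, hmellin]
  · simpa only [VerticalIntegrable, hmellin] using verticalIntegrable_one_div_mul_add_one hσ

theorem call_payoff_integral_representation
    (K : ℝ) (hK : 0 < K) (R : ℝ) (hR : 1 < R) (s : ℝ) (hs : 0 < s) :
    Integrable (fun x : ℝ =>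
      Complex.exp ((↑R + ↑x * I) * Real.log s) *
        Complex.exp ((1 - (↑R + ↑x * I)) * Real.log K) /
          ((↑R + ↑x * I) * ((↑R + ↑x * I) - 1))) ∧
    (1 / (2 * π)) * ∫ x : ℝ,
        Complex.exp ((↑R + ↑x * I) * Real.log s) *
          Complex.exp ((1 - (↑R + ↑x * I)) * Real.log K) /
            ((↑R + ↑x * I) * ((↑R + ↑x * I) - 1))
      = ↑(max (s - K) 0) := by
  have hσ : 0 < R - 1 := sub_pos.2 hR
  have hx : 0 < K / s := div_pos hK hs
  have hden (y : ℝ) : ((R : ℂ) + y * I) * ((R + y * I) - 1) =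
      ((R - 1 : ℝ) + y * I) * ((R - 1 : ℝ) + y * I + 1) := by
    push_cast
    ring
  constructor
  · have hint := verticalIntegrable_one_div_mul_add_one hσ
    simp_rw [hden, div_eq_mul_one_div (_ * _ : ℂ) (_ * _)]
    refine hint.bdd_mul
      (c := Real.exp (R * Real.log s) * Real.exp ((1 - R) * Real.log K))
      (by fun_prop) (.of_forall fun y => ?_)
    simp [Complex.norm_exp]
  · have hinv := mellinInv_one_div_mul_add_one hσ hx
    have hpow (y : ℝ) : cexp ((R + y * I) * Real.log s) * cexp ((1 - (R + y * I)) * Real.log K) =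
        s * ((K / s : ℝ) : ℂ) ^ (-((R - 1 : ℝ) + y * I) : ℂ) := by
      rw [cpow_def_of_ne_zero (ofReal_ne_zero.2 hx.ne'), ← Complex.ofReal_log hx.le,
        Real.log_div hK.ne' hs.ne', ← Complex.exp_add]
      nth_rewrite 2 [← Real.exp_log hs]
      rw [Complex.ofReal_exp, ← Complex.exp_add]
      push_cast
      ring_nf
    have hmax : s * max (1 - K / s) 0 = max (s - K) 0 := by
      rw [mul_max_of_nonneg _ _ hs.le, mul_sub, mul_div_cancel₀ _ hs.ne', mul_one, mul_zero]
    rw [← hmax, ofReal_mul, ← hinv, mellinInv]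
    simp_rw [hden, hpow, div_eq_mul_one_div (_ * _ : ℂ) (_ * _), mul_assoc (s : ℂ),
      integral_const_mul, smul_eq_mul]
    rw [Complex.real_smul]
    push_cast
    ring
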